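/- Let 0<s<1. Define, for m = (m₁,m₂) ∈ ℤ² with m₁,m₂ ≠ 0, K_s(m) = (1/|Γ(−s)|) ∫_0^∞ e^{−4t} I_{|m₁|}(2t) I_{|m₂|}(2t) t^{−1−s} dt. Then ‖m‖₂^{2+2s} K_s(m) tends to c_{2,s} = 4^s Γ(1+s) / (π |Γ(−s)|) as min(|m₁|,|m₂|) → ∞; that is, for every ε>0 there exists N such that |‖m‖₂^{2+2s} K_s(m) − c_{2,s}| < ε whenever |m₁| ≥ N and |m₂| ≥ N, where ‖m‖₂ = (m₁² + m₂²)^{1/2}. -/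

import Mathlib

open Real MeasureTheory

/-- The modified Bessel function of the first kind of integer order `k ≥ 0`,
defined by its everywhere-convergent power series. -/
noncomputable def besselI (k : ℕ) (x : ℝ) : ℝ :=
  ∑' j : ℕ, (x / 2) ^ (2 * j + k) / ((j.factorial : ℝ) * ((j + k).factorial : ℝ))

/-- The kernel of the two-dimensional fractional discrete Laplacian. -/
noncomputable def Ks2 (s : ℝ) (m₁ m₂ : ℤ) : ℝ :=
  (1 / |Real.Gamma (-s)|) *
    ∫ t in Set.Ioi (0 : ℝ),
      Real.exp (-4 * t) * besselI m₁.natAbs (2 * t) * besselI m₂.natAbs (2 * t) * t ^ (-1 - s)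

lemma integral_exp_int_mul_I (n : ℤ) :
    ∫ θ in (-π)..π, Complex.exp (n * (θ * Complex.I)) = if n = 0 then (2 * π : ℂ) else 0 := by
  split_ifs with h
  · simp [h, Complex.ext_iff]; ring
  · have h' : (n : ℂ) * Complex.I ≠ 0 := by simp [h]
    have := integral_exp_mul_complex (a := -π) (b := π) h'
    simp_rw [show ∀ θ : ℝ, (n : ℂ) * (θ * Complex.I) = n * Complex.I * θ from fun θ => by ring]
    rw [this, div_eq_zero_iff]
    left
    rw [sub_eq_zero, Complex.exp_eq_exp_iff_exists_int]
    exact ⟨n, by push_cast; ring⟩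

/-- The Fourier (Schläfli) representation of `I_k (2t)` on the circle of radius `r`. -/
lemma besselI_mul_pow_eq_integral (k : ℕ) (t : ℝ) {r : ℝ} (hr : 0 < r) :
    (2 * π * (besselI k (2 * t) * r ^ k) : ℂ) =
      ∫ θ in (-π)..π, Complex.exp (t * r * Complex.exp (θ * Complex.I)) *
        Complex.exp (t * r⁻¹ * Complex.exp (-(θ * Complex.I))) *
        Complex.exp (-(k * (θ * Complex.I))) := by
  have hr' : (r : ℂ) ≠ 0 := by exact_mod_cast hr.ne'
  have hexp : ∀ z : ℂ, HasSum (fun n : ℕ => z ^ n / n.factorial) (Complex.exp z) := fun z => by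
    rw [Complex.exp_eq_exp_ℂ]; exact NormedSpace.expSeries_div_hasSum_exp z
  have hexpR : ∀ x : ℝ, Summable (fun n : ℕ => x ^ n / n.factorial) :=
    Real.summable_pow_div_factorial
  have hnorm : ∀ z : ℂ, Summable (fun n : ℕ => ‖z ^ n / n.factorial‖) := fun z => by
    simpa using hexpR ‖z‖
  have hmul : ∀ z w : ℂ, HasSum (fun p : ℕ × ℕ =>
      z ^ p.1 / p.1.factorial * (w ^ p.2 / p.2.factorial)) (Complex.exp z * Complex.exp w) :=
    fun z w => HasSum.mul (f := fun n : ℕ => z ^ n / n.factorial)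
      (g := fun n : ℕ => w ^ n / n.factorial) (hexp z) (hexp w)
      (summable_mul_of_summable_norm (f := fun n : ℕ => z ^ n / n.factorial)
        (g := fun n : ℕ => w ^ n / n.factorial) (hnorm z) (hnorm w))
  let F : ℕ × ℕ → ℝ → ℂ := fun p θ =>
    ((t * r) ^ p.1 / p.1.factorial * ((t * r⁻¹) ^ p.2 / p.2.factorial) : ℂ) *
      Complex.exp (((p.1 : ℤ) - p.2 - k : ℤ) * (θ * Complex.I))
  have hF : ∀ p θ, F p θ =
      (t * r * Complex.exp (θ * Complex.I)) ^ p.1 / p.1.factorial *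
      ((t * r⁻¹ * Complex.exp (-(θ * Complex.I))) ^ p.2 / p.2.factorial) *
      Complex.exp (-(k * (θ * Complex.I))) := by
    intro p θ
    simp only [F]
    rw [mul_pow _ (Complex.exp _), mul_pow _ (Complex.exp _), ← Complex.exp_nat_mul,
      ← Complex.exp_nat_mul,
      show (((p.1 : ℤ) - p.2 - k : ℤ) : ℂ) * (θ * Complex.I) =
        p.1 * (θ * Complex.I) + p.2 * -(θ * Complex.I) + -(k * (θ * Complex.I)) by
          push_cast; ring, Complex.exp_add, Complex.exp_add]
    ring
  have hS : HasSum (fun p => ∫ θ in (-π)..π, F p θ) (∫ θ in (-π)..π,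
      Complex.exp (t * r * Complex.exp (θ * Complex.I)) *
        Complex.exp (t * r⁻¹ * Complex.exp (-(θ * Complex.I))) *
        Complex.exp (-(k * (θ * Complex.I)))) := by
    have hsum : Summable fun p : ℕ × ℕ =>
        |t * r| ^ p.1 / p.1.factorial * (|t * r⁻¹| ^ p.2 / p.2.factorial) :=
      Summable.mul_of_nonneg (hexpR _) (hexpR _) (fun n => by positivity) (fun n => by positivity)
    refine intervalIntegral.hasSum_integral_of_dominated_convergence
      (fun p _ => |t * r| ^ p.1 / p.1.factorial * (|t * r⁻¹| ^ p.2 / p.2.factorial)) ?_ ?_ ?_ ?_ ?_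
    · intro p
      apply Continuous.aestronglyMeasurable
      simp only [F]
      fun_prop
    · intro p
      refine .of_forall fun θ _ => le_of_eq ?_
      have : ‖Complex.exp (((p.1 : ℤ) - p.2 - k : ℤ) * (θ * Complex.I))‖ = 1 := by
        rw [show (((p.1 : ℤ) - p.2 - k : ℤ) : ℂ) * (θ * Complex.I) =
          (((p.1 : ℤ) - p.2 - k : ℤ) * θ : ℝ) * Complex.I by push_cast; ring]
        exact Complex.norm_exp_ofReal_mul_I _
      simp only [F, norm_mul, this, norm_div, norm_pow, mul_one, Complex.norm_real,
        Complex.norm_natCast, abs_mul, Real.norm_eq_abs, norm_inv, abs_inv]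
    · exact .of_forall fun θ _ => hsum
    · exact intervalIntegrable_const
    · refine .of_forall fun θ _ => ?_
      simp only [hF]
      exact (hmul _ _).mul_right _
  have hinj : Function.Injective (fun j : ℕ => (j + k, j)) := fun a b h => by simpa using h
  rw [← hinj.hasSum_iff] at hS
  · rw [← hS.tsum_eq, besselI, Complex.ofReal_tsum, ← tsum_mul_right, ← tsum_mul_left]
    congr 1
    ext j
    simp only [Function.comp, F, intervalIntegral.integral_const_mul, integral_exp_int_mul_I]
    rw [if_pos (by push_cast; ring)]
    have hrj : (r : ℂ) ^ j * (r : ℂ)⁻¹ ^ j = 1 := by rw [← mul_pow, mul_inv_cancel₀ hr', one_pow]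
    push_cast
    linear_combination
      -(2 * π * t ^ (2 * j + k) * r ^ k / (j.factorial * (j + k).factorial) : ℂ) * hrj
  · rintro ⟨a, b⟩ h
    simp only [F, intervalIntegral.integral_const_mul, integral_exp_int_mul_I]
    rw [if_neg, mul_zero]
    intro h'
    exact h ⟨b, by ext <;> simp; omega⟩

/-- The one-dimensional discrete heat kernel `e^{-2t} I_k(2t)`. -/
noncomputable def discreteHeat (k : ℕ) (t : ℝ) : ℝ := Real.exp (-2 * t) * besselI k (2 * t)

lemma discreteHeat_eq_integral (k : ℕ) (t : ℝ) :
    (2 * π * discreteHeat k t : ℂ) =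
      ∫ θ in (-π)..π, (Real.exp (-(2 * t * (1 - cos θ))) : ℂ) *
        Complex.exp (-(k * (θ * Complex.I))) := by
  have h := besselI_mul_pow_eq_integral k t one_pos
  simp only [Complex.ofReal_one, one_pow, mul_one, inv_one, ← Complex.exp_add] at h
  rw [discreteHeat, Complex.ofReal_mul, mul_left_comm, h, ← intervalIntegral.integral_const_mul]
  congr 1
  ext θ
  rw [Complex.ofReal_exp, Complex.ofReal_exp, ← Complex.exp_add, ← Complex.exp_add]
  congr 1
  have h2 := Complex.two_cos (θ : ℂ)
  rw [neg_mul] at h2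
  push_cast
  linear_combination (-t : ℂ) * h2

lemma continuous_discreteHeat (k : ℕ) : Continuous (discreteHeat k) := by
  have h : ∀ t, discreteHeat k t = (2 * π)⁻¹ * (∫ θ in (-π)..π,
      (Real.exp (-(2 * t * (1 - cos θ))) : ℂ) * Complex.exp (-(k * (θ * Complex.I)))).re := by
    intro t
    rw [← discreteHeat_eq_integral, show (2 * π * discreteHeat k t : ℂ) =
      ((2 * π * discreteHeat k t : ℝ) : ℂ) by push_cast; ring, Complex.ofReal_re]
    field_simp
  rw [funext h]
  refine continuous_const.mul (Complex.continuous_re.comp ?_)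
  apply intervalIntegral.continuous_parametric_intervalIntegral_of_continuous'
  unfold Function.uncurry
  fun_prop

lemma exp_neg_mul_one_sub_cos_le {t θ : ℝ} (ht : 0 ≤ t) (hθ : |θ| ≤ π) :
    Real.exp (-(2 * t * (1 - cos θ))) ≤ Real.exp (-(4 * t / π ^ 2) * θ ^ 2) := by
  rw [Real.exp_le_exp]
  have h := mul_le_mul_of_nonneg_left (Real.cos_le_one_sub_mul_cos_sq hθ) ht
  have : -(4 * t / π ^ 2) * θ ^ 2 = 2 * (t * (1 - 2 / π ^ 2 * θ ^ 2)) - 2 * t := by ring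
  rw [this]
  linarith

lemma integral_exp_neg_mul_one_sub_cos_le {t : ℝ} (ht : 0 < t) :
    ∫ θ in (-π)..π, Real.exp (-(2 * t * (1 - cos θ))) ≤ 2 * π / √t := by
  have hb : 0 < 4 * t / π ^ 2 := by positivity
  have hint := integrable_exp_neg_mul_sq hb
  calc ∫ θ in (-π)..π, Real.exp (-(2 * t * (1 - cos θ)))
      ≤ ∫ θ in (-π)..π, Real.exp (-(4 * t / π ^ 2) * θ ^ 2) := by
        refine intervalIntegral.integral_mono_on (by linarith [pi_pos])
          (Continuous.intervalIntegrable (by fun_prop) _ _)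
          (Continuous.intervalIntegrable (by fun_prop) _ _) fun θ hθ => ?_
        exact exp_neg_mul_one_sub_cos_le ht.le (abs_le.2 hθ)
    _ ≤ ∫ θ, Real.exp (-(4 * t / π ^ 2) * θ ^ 2) := by
        rw [intervalIntegral.integral_of_le (by linarith [pi_pos])]
        exact setIntegral_le_integral hint (.of_forall fun θ => (Real.exp_pos _).le)
    _ = √(π / (4 * t / π ^ 2)) := integral_gaussian _
    _ ≤ √((2 * π) ^ 2 / t) := by
        refine Real.sqrt_le_sqrt ?_
        rw [show π / (4 * t / π ^ 2) = (π ^ 2 * (π / 4)) / t by field_simp]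
        gcongr
        nlinarith [pi_lt_four, sq_nonneg π]
    _ = 2 * π / √t := by
        rw [Real.sqrt_div (by positivity), Real.sqrt_sq (by positivity)]

lemma abs_discreteHeat_mul_pow_le (k : ℕ) {t r : ℝ} (ht : 0 < t) (hr : 0 < r) :
    |discreteHeat k t| * r ^ k ≤ Real.exp (t * (r + r⁻¹ - 2)) / √t := by
  have hr2 : 2 ≤ r + r⁻¹ := by
    have : r + r⁻¹ - 2 = (r - 1) ^ 2 / r := by field_simp; ring
    have : 0 ≤ (r - 1) ^ 2 / r := by positivity
    linarith
  have h := congrArg norm (besselI_mul_pow_eq_integral k t hr)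
  have hle := intervalIntegral.norm_integral_le_integral_norm (a := -π) (b := π)
    (f := fun θ : ℝ => Complex.exp (t * r * Complex.exp (θ * Complex.I)) *
        Complex.exp (t * r⁻¹ * Complex.exp (-(θ * Complex.I))) *
        Complex.exp (-(k * (θ * Complex.I)))) (μ := volume) (by linarith [pi_pos])
  rw [← h] at hle
  have hpt : ∀ θ : ℝ, ‖Complex.exp (t * r * Complex.exp (θ * Complex.I)) *
        Complex.exp (t * r⁻¹ * Complex.exp (-(θ * Complex.I))) *
        Complex.exp (-(k * (θ * Complex.I)))‖ = Real.exp (t * (r + r⁻¹) * cos θ) := by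
    intro θ
    rw [← Complex.exp_add, ← Complex.exp_add, Complex.norm_exp]
    congr 1
    have h1 : Complex.exp (θ * Complex.I) = (cos θ : ℂ) + (sin θ : ℂ) * Complex.I := by
      rw [Complex.exp_mul_I]; simp
    have h2 : Complex.exp (-(θ * Complex.I)) = (cos θ : ℂ) - (sin θ : ℂ) * Complex.I := by
      rw [← neg_mul, Complex.exp_mul_I]; simp [sub_eq_add_neg]
    rw [h1, h2]
    simp [-Complex.ofReal_cos, -Complex.ofReal_sin]
    ring
  simp only [hpt] at hle
  have hnorm : ‖(2 * π * (besselI k (2 * t) * r ^ k) : ℂ)‖ =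
      2 * π * (|besselI k (2 * t)| * r ^ k) := by
    simp [abs_of_pos pi_pos, abs_of_pos hr]
  rw [hnorm] at hle
  have hmono : ∫ θ in (-π)..π, Real.exp (t * (r + r⁻¹) * cos θ) ≤
      ∫ θ in (-π)..π, Real.exp (t * (r + r⁻¹)) * Real.exp (-(2 * t * (1 - cos θ))) := by
    refine intervalIntegral.integral_mono_on (by linarith [pi_pos])
      (Continuous.intervalIntegrable (by fun_prop) _ _)
      (Continuous.intervalIntegrable (by fun_prop) _ _) fun θ _ => ?_
    rw [← Real.exp_add, Real.exp_le_exp]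
    nlinarith [mul_nonneg (mul_nonneg ht.le (sub_nonneg.2 hr2)) (sub_nonneg.2 (cos_le_one θ))]
  rw [intervalIntegral.integral_const_mul] at hmono
  have hfin : 2 * π * (|besselI k (2 * t)| * r ^ k) ≤
      Real.exp (t * (r + r⁻¹)) * (2 * π / √t) :=
    (hle.trans hmono).trans
      (mul_le_mul_of_nonneg_left (integral_exp_neg_mul_one_sub_cos_le ht) (Real.exp_pos _).le)
  have hfin' : |besselI k (2 * t)| * r ^ k ≤ Real.exp (t * (r + r⁻¹)) / √t := by
    refine le_of_mul_le_mul_left (hfin.trans_eq ?_) two_pi_pos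
    ring
  rw [discreteHeat, abs_mul, abs_of_pos (Real.exp_pos _), mul_assoc]
  refine (mul_le_mul_of_nonneg_left hfin' (Real.exp_pos _).le).trans_eq ?_
  rw [← mul_div_assoc, ← Real.exp_add]
  ring_nf

/-- Gaussian-type decay of the discrete heat kernel, uniform over all times. -/
lemma abs_discreteHeat_le {k : ℕ} (hk : 4 ≤ k) {t : ℝ} (ht : 0 < t) :
    |discreteHeat k t| ≤ (1 + (k : ℝ) ^ 2 / (8 * t))⁻¹ ^ 2 / √t := by
  have hk0 : (4 : ℝ) ≤ k := by exact_mod_cast hk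
  set δ : ℝ := k / (2 * t) with hδ
  have hδ0 : 0 < δ := by positivity
  have h := abs_discreteHeat_mul_pow_le k ht (r := 1 + δ) (by positivity)
  have hexp : Real.exp (t * ((1 + δ) + (1 + δ)⁻¹ - 2)) ≤ (1 + δ) ^ ((k : ℝ) / 2) := by
    rw [Real.rpow_def_of_pos (by positivity), Real.exp_le_exp]
    have hlog := Real.one_sub_inv_le_log_of_pos (show 0 < 1 + δ by positivity)
    have : t * ((1 + δ) + (1 + δ)⁻¹ - 2) = (1 - (1 + δ)⁻¹) * (k / 2) := by
      have : (k : ℝ) = δ * (2 * t) := by rw [hδ]; field_simp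
      rw [this]; field_simp; ring
    rw [this]
    gcongr
  have hbern : 1 + (k : ℝ) ^ 2 / (8 * t) ≤ (1 + δ) ^ ((k : ℝ) / 4) := by
    refine le_trans (le_of_eq ?_) (one_add_mul_self_le_rpow_one_add (by linarith) (by linarith))
    rw [hδ]; field_simp; ring
  have hhalf : (1 + (k : ℝ) ^ 2 / (8 * t)) ^ 2 ≤ (1 + δ) ^ ((k : ℝ) / 2) := by
    calc _ ≤ ((1 + δ) ^ ((k : ℝ) / 4)) ^ 2 := by gcongr
      _ = _ := by rw [← Real.rpow_mul_natCast (by positivity)]; congr 1; push_cast; ring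
  have hpow : (1 + δ) ^ k = (1 + δ) ^ ((k : ℝ) / 2) * (1 + δ) ^ ((k : ℝ) / 2) := by
    rw [← Real.rpow_add (by positivity), add_halves, Real.rpow_natCast]
  set P := (1 + δ) ^ ((k : ℝ) / 2) with hP
  have hPpos : 0 < P := by positivity
  have ht' : 0 < √t := Real.sqrt_pos.2 ht
  have h1 : |discreteHeat k t| ≤ P⁻¹ / √t := by
    have h2 : |discreteHeat k t| * (P * P) ≤ P / √t := by
      rw [← hpow]; exact h.trans (by gcongr)
    refine le_of_mul_le_mul_right (h2.trans_eq ?_) (mul_pos hPpos hPpos)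
    field_simp
  refine h1.trans ?_
  rw [inv_pow]
  gcongr

open Filter Topology

lemma tendsto_sq_mul_one_sub_cos_div (x : ℝ) :
    Tendsto (fun R : ℝ => 2 * R ^ 2 * (1 - cos (x / R))) atTop (𝓝 (x ^ 2)) := by
  have h0 : Tendsto (fun R : ℝ => x / R / 2) atTop (𝓝 0) := by
    simpa using (tendsto_id.const_div_atTop x).div_const 2
  have h : Tendsto (fun R : ℝ => x ^ 2 * sinc (x / R / 2) ^ 2) atTop (𝓝 (x ^ 2)) := by
    simpa using ((continuous_sinc.tendsto 0).comp h0).pow 2 |>.const_mul (x ^ 2)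
  refine h.congr' ?_
  filter_upwards [eventually_gt_atTop 0] with R hR
  have hcos : 1 - cos (x / R) = 2 * sin (x / R / 2) ^ 2 := by
    have := cos_sq' (x / R / 2)
    have h2 := cos_sq (x / R / 2)
    rw [mul_div_cancel₀ _ (two_ne_zero' ℝ)] at h2
    linarith
  rw [hcos]
  rcases eq_or_ne x 0 with rfl | hx
  · simp
  · rw [sinc_of_ne_zero (by positivity)]
    field_simp

/-- The `L¹` distance between the rescaled symbol of the discrete heat semigroup and the
Gaussian. -/
noncomputable def symbolError (u R : ℝ) : ℝ :=
  ∫ x, |(Set.Ioc (-(π * R)) (π * R)).indicator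
    (fun x => Real.exp (-(2 * (R ^ 2 * u) * (1 - cos (x / R))))) x - Real.exp (-u * x ^ 2)|

lemma abs_le_pi_of_mem {R x : ℝ} (hR : 0 < R) (hx : x ∈ Set.Ioc (-(π * R)) (π * R)) :
    |x / R| ≤ π := by
  rw [abs_div, abs_of_pos hR, div_le_iff₀ hR]
  exact abs_le.2 ⟨hx.1.le, hx.2⟩

lemma indicator_symbol_le {u R : ℝ} (hu : 0 < u) (hR : 0 < R) (x : ℝ) :
    (Set.Ioc (-(π * R)) (π * R)).indicator
      (fun x => Real.exp (-(2 * (R ^ 2 * u) * (1 - cos (x / R))))) x ≤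
      Real.exp (-(4 * u / π ^ 2) * x ^ 2) := by
  by_cases hx : x ∈ Set.Ioc (-(π * R)) (π * R)
  · rw [Set.indicator_of_mem hx]
    refine (exp_neg_mul_one_sub_cos_le (by positivity) (abs_le_pi_of_mem hR hx)).trans_eq ?_
    congr 1
    field_simp
  · rw [Set.indicator_of_notMem hx]
    exact (Real.exp_pos _).le

lemma indicator_symbol_nonneg (u R x : ℝ) :
    0 ≤ (Set.Ioc (-(π * R)) (π * R)).indicator
      (fun x => Real.exp (-(2 * (R ^ 2 * u) * (1 - cos (x / R))))) x :=
  Set.indicator_nonneg (fun _ _ => (Real.exp_pos _).le) x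

lemma measurable_indicator_symbol (u R : ℝ) :
    Measurable ((Set.Ioc (-(π * R)) (π * R)).indicator
      (fun x => Real.exp (-(2 * (R ^ 2 * u) * (1 - cos (x / R)))))) :=
  Measurable.indicator (by fun_prop) measurableSet_Ioc

lemma tendsto_symbolError {u : ℝ} (hu : 0 < u) : Tendsto (symbolError u) atTop (𝓝 0) := by
  have h := tendsto_integral_filter_of_dominated_convergence (μ := volume) (l := atTop)
    (F := fun (R x : ℝ) => |(Set.Ioc (-(π * R)) (π * R)).indicator
      (fun x => Real.exp (-(2 * (R ^ 2 * u) * (1 - cos (x / R))))) x - Real.exp (-u * x ^ 2)|)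
    (f := fun _ => 0)
    (fun x => Real.exp (-(4 * u / π ^ 2) * x ^ 2) + Real.exp (-u * x ^ 2)) ?_ ?_ ?_ ?_
  · rwa [integral_zero] at h
  · refine .of_forall fun R => Measurable.aestronglyMeasurable ?_
    exact ((measurable_indicator_symbol u R).sub (by fun_prop)).abs
  · filter_upwards [eventually_gt_atTop 0] with R hR
    refine .of_forall fun x => ?_
    rw [Real.norm_eq_abs, abs_abs]
    have h1 := indicator_symbol_le hu hR x
    have h2 := indicator_symbol_nonneg u R x
    have h3 := Real.exp_pos (-u * x ^ 2)
    have h4 := Real.exp_pos (-(4 * u / π ^ 2) * x ^ 2)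
    rw [abs_le]
    constructor <;> linarith
  · exact (integrable_exp_neg_mul_sq (by positivity)).add (integrable_exp_neg_mul_sq hu)
  · refine .of_forall fun x => ?_
    have hlim : Tendsto (fun R : ℝ => (Set.Ioc (-(π * R)) (π * R)).indicator
        (fun x => Real.exp (-(2 * (R ^ 2 * u) * (1 - cos (x / R))))) x) atTop
        (𝓝 (Real.exp (-u * x ^ 2))) := by
      have h1 : Tendsto (fun R : ℝ => Real.exp (-u * (2 * R ^ 2 * (1 - cos (x / R))))) atTop
          (𝓝 (Real.exp (-u * x ^ 2))) :=
        (Real.continuous_exp.tendsto _).comp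
          ((tendsto_sq_mul_one_sub_cos_div x).const_mul (-u))
      refine h1.congr' ?_
      filter_upwards [eventually_gt_atTop |x|] with R hR
      have hR0 : 0 < R := (abs_nonneg x).trans_lt hR
      have hx := abs_lt.1 (hR.trans_le (le_mul_of_one_le_left hR0.le (by linarith [pi_gt_three]) :
        R ≤ π * R))
      rw [Set.indicator_of_mem (Set.mem_Ioc.2 ⟨hx.1, hx.2.le⟩)]
      congr 1
      ring
    simpa only [abs_zero] using (tendsto_sub_nhds_zero_iff.2 hlim).abs

lemma abs_discreteHeat_sub_gaussian_le (k : ℕ) {u R : ℝ} (hu : 0 < u) (hR : 0 < R) :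
    |R * discreteHeat k (R ^ 2 * u) -
      Real.exp (-(k ^ 2 / R ^ 2) / (4 * u)) / √(4 * π * u)| ≤ symbolError u R := by
  have hRc : (R : ℂ) ≠ 0 := by exact_mod_cast hR.ne'
  have h1 : (2 * π * (R * discreteHeat k (R ^ 2 * u)) : ℂ) = ∫ x : ℝ,
      (((Set.Ioc (-(π * R)) (π * R)).indicator
        (fun x => Real.exp (-(2 * (R ^ 2 * u) * (1 - cos (x / R))))) x : ℝ) : ℂ) *
        Complex.exp (-(k * ((x / R : ℝ) * Complex.I))) := by
    have h := intervalIntegral.integral_comp_div (a := -(π * R)) (b := π * R)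
      (fun θ : ℝ => (Real.exp (-(2 * (R ^ 2 * u) * (1 - cos θ))) : ℂ) *
        Complex.exp (-(k * (θ * Complex.I)))) hR.ne'
    rw [neg_div, mul_div_cancel_right₀ _ hR.ne', ← discreteHeat_eq_integral,
      intervalIntegral.integral_of_le (by nlinarith [mul_pos pi_pos hR]),
      ← integral_indicator measurableSet_Ioc] at h
    rw [mul_left_comm, ← Complex.real_smul, ← h]
    congr 1
    ext x
    by_cases hx : x ∈ Set.Ioc (-(π * R)) (π * R)
    · simp only [Set.indicator_of_mem hx]
    · simp [Set.indicator_of_notMem hx]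
  have h2 : (2 * π * (Real.exp (-(k ^ 2 / R ^ 2) / (4 * u)) / √(4 * π * u) : ℝ) : ℂ) = ∫ x : ℝ,
      (Real.exp (-u * x ^ 2) : ℂ) * Complex.exp (-(k * ((x / R : ℝ) * Complex.I))) := by
    have h := fourierIntegral_gaussian (b := u) (by simpa using hu) (-(k / R : ℝ) : ℂ)
    have hs : ((π : ℂ) / u) ^ (1 / 2 : ℂ) = (√(π / u) : ℝ) := by
      rw [Real.sqrt_eq_rpow, Complex.ofReal_cpow (by positivity)]
      push_cast
      rfl
    rw [hs] at h
    have h' : 2 * π / √(4 * π * u) = √(π / u) := by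
      rw [div_eq_iff (by positivity), ← Real.sqrt_mul (by positivity),
        show π / u * (4 * π * u) = (2 * π) ^ 2 by field_simp; norm_num,
        Real.sqrt_sq (by positivity)]
    have h3 : (2 * π * (Real.exp (-(k ^ 2 / R ^ 2) / (4 * u)) / √(4 * π * u) : ℝ) : ℂ) =
        (√(π / u) : ℝ) * Complex.exp (-(-(k / R : ℝ) : ℂ) ^ 2 / (4 * u)) := by
      rw [← h']
      push_cast
      rw [show (-(-(k / R : ℂ)) ^ 2 / (4 * u) : ℂ) = -(k ^ 2 / R ^ 2) / (4 * u) by ring]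
      ring
    rw [h3, ← h]
    congr 1
    ext x
    rw [mul_comm, Complex.ofReal_exp]
    congr 2
    · push_cast; ring
    · push_cast; ring
  have hint1 : Integrable (fun x => (Set.Ioc (-(π * R)) (π * R)).indicator
      (fun x => Real.exp (-(2 * (R ^ 2 * u) * (1 - cos (x / R))))) x) := by
    refine (integrable_exp_neg_mul_sq (b := 4 * u / π ^ 2) (by positivity)).mono'
      (measurable_indicator_symbol u R).aestronglyMeasurable (.of_forall fun x => ?_)
    rw [Real.norm_of_nonneg (indicator_symbol_nonneg u R x)]
    exact indicator_symbol_le hu hR x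
  have hint2 := integrable_exp_neg_mul_sq hu
  have hunit : ∀ x : ℝ, ‖Complex.exp (-(k * ((x / R : ℝ) * Complex.I)))‖ = 1 := fun x => by
    rw [show (-(k * ((x / R : ℝ) * Complex.I)) : ℂ) = (-(k * (x / R)) : ℝ) * Complex.I by
      push_cast; ring]
    exact Complex.norm_exp_ofReal_mul_I _
  have hmul : ∀ f : ℝ → ℝ, Integrable f → Integrable fun x : ℝ =>
      (f x : ℂ) * Complex.exp (-(k * ((x / R : ℝ) * Complex.I))) := fun f hf =>
    hf.ofReal.mul_bdd (c := 1) (Continuous.aestronglyMeasurable (by fun_prop))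
      (.of_forall fun x => (hunit x).le)
  have h3 : (2 * π * (R * discreteHeat k (R ^ 2 * u) -
      Real.exp (-(k ^ 2 / R ^ 2) / (4 * u)) / √(4 * π * u) : ℝ) : ℂ) = ∫ x : ℝ,
      (((Set.Ioc (-(π * R)) (π * R)).indicator
        (fun x => Real.exp (-(2 * (R ^ 2 * u) * (1 - cos (x / R))))) x -
          Real.exp (-u * x ^ 2) : ℝ) : ℂ) *
        Complex.exp (-(k * ((x / R : ℝ) * Complex.I))) := by
    rw [Complex.ofReal_sub, mul_sub, h2, Complex.ofReal_mul, h1,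
      ← integral_sub (hmul _ hint1) (hmul _ hint2)]
    simp only [Complex.ofReal_sub, sub_mul]
  have h4 := norm_integral_le_integral_norm (μ := volume) (fun x : ℝ =>
      (((Set.Ioc (-(π * R)) (π * R)).indicator
        (fun x => Real.exp (-(2 * (R ^ 2 * u) * (1 - cos (x / R))))) x -
          Real.exp (-u * x ^ 2) : ℝ) : ℂ) *
        Complex.exp (-(k * ((x / R : ℝ) * Complex.I))))
  rw [← h3] at h4
  simp only [norm_mul, hunit, mul_one, Complex.norm_real, Complex.norm_ofNat, Real.norm_eq_abs,
    abs_of_pos pi_pos] at h4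
  refine le_trans ?_ h4
  refine le_mul_of_one_le_left (abs_nonneg _) ?_
  linarith [pi_gt_three]

lemma integral_inv_mul_exp_neg_inv {s : ℝ} (hs0 : 0 < s) :
    ∫ u in Set.Ioi (0 : ℝ), Real.exp (-(1 / (4 * u))) / (4 * π * u) * u ^ (-1 - s) =
      4 ^ s * Real.Gamma (1 + s) / π := by
  have h := integral_comp_rpow_Ioi (fun v : ℝ => v ^ ((s + 1) - 1) * Real.exp (-(1 / 4 * v)))
    (p := -1) (by norm_num)
  rw [Real.integral_rpow_mul_exp_neg_mul_Ioi (by linarith) (by norm_num)] at h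
  have h' : ∀ u ∈ Set.Ioi (0 : ℝ),
      Real.exp (-(1 / (4 * u))) / (4 * π * u) * u ^ (-1 - s) = (4 * π)⁻¹ *
        ((|(-1 : ℝ)| * u ^ ((-1 : ℝ) - 1)) •
          ((u ^ (-1 : ℝ)) ^ ((s + 1) - 1) * Real.exp (-(1 / 4 * u ^ (-1 : ℝ))))) := by
    intro u hu
    have hu : 0 < u := hu
    rw [add_sub_cancel_right, ← Real.rpow_mul hu.le, abs_neg, abs_one, one_mul, smul_eq_mul,
      ← mul_assoc (u ^ _), ← Real.rpow_add hu, show (-1 : ℝ) - 1 + -1 * s = -1 + (-1 - s) by ring,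
      Real.rpow_add hu, Real.rpow_neg_one]
    rw [show 1 / 4 * u⁻¹ = 1 / (4 * u) by field_simp]
    field_simp
  rw [setIntegral_congr_fun measurableSet_Ioi h', integral_const_mul, h, one_div_one_div,
    Real.rpow_add (by norm_num), Real.rpow_one, add_comm s 1]
  field_simp

/-- The common integrable majorant of the rescaled kernels. -/
noncomputable def kernelMajorant (s u : ℝ) : ℝ := if u ≤ 1 then 64 * u ^ (-s) else u ^ (-2 - s)

lemma integrableOn_kernelMajorant {s : ℝ} (hs0 : 0 < s) (hs1 : s < 1) :
    IntegrableOn (kernelMajorant s) (Set.Ioi 0) := by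
  rw [← Set.Ioc_union_Ioi_eq_Ioi (zero_le_one' ℝ)]
  refine IntegrableOn.union ?_ ?_
  · refine IntegrableOn.congr_fun (f := fun u => 64 * u ^ (-s)) ?_ (fun u hu => ?_)
      measurableSet_Ioc
    · refine Integrable.const_mul ?_ _
      rw [← IntegrableOn, ← intervalIntegrable_iff_integrableOn_Ioc_of_le zero_le_one]
      exact intervalIntegral.intervalIntegrable_rpow' (by linarith)
    · rw [kernelMajorant, if_pos hu.2]
  · refine IntegrableOn.congr_fun (f := fun u => u ^ (-2 - s)) ?_ (fun u hu => ?_)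
      measurableSet_Ioi
    · exact integrableOn_Ioi_rpow_of_lt (by linarith) one_pos
    · rw [kernelMajorant, if_neg (not_le.2 hu)]

lemma abs_rescaled_kernel_le {k l : ℕ} (hk : 4 ≤ k) (hl : 4 ≤ l) {s R u : ℝ} (hR : 0 < R)
    (hRkl : R ^ 2 = (k : ℝ) ^ 2 + (l : ℝ) ^ 2) (hu : 0 < u) :
    |R * discreteHeat k (R ^ 2 * u) * (R * discreteHeat l (R ^ 2 * u)) * u ^ (-1 - s)| ≤
      kernelMajorant s u := by
  have ht : 0 < R ^ 2 * u := by positivity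
  have hk' := abs_discreteHeat_le hk ht
  have hl' := abs_discreteHeat_le hl ht
  set a : ℝ := (k : ℝ) ^ 2 / (8 * (R ^ 2 * u)) with ha
  set b : ℝ := (l : ℝ) ^ 2 / (8 * (R ^ 2 * u)) with hb
  have ha0 : 0 ≤ a := by positivity
  have hb0 : 0 ≤ b := by positivity
  have hab : a + b = 1 / (8 * u) := by
    rw [ha, hb, ← add_div, ← hRkl]; field_simp
  have hsqrt : √(R ^ 2 * u) = R * √u := by rw [Real.sqrt_mul (by positivity), Real.sqrt_sq hR.le]
  have hsu : √u * √u = u := Real.mul_self_sqrt hu.le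
  have hsu0 : 0 < √u := Real.sqrt_pos.2 hu
  have hprod : |R * discreteHeat k (R ^ 2 * u) * (R * discreteHeat l (R ^ 2 * u))| ≤
      (1 + 1 / (8 * u))⁻¹ ^ 2 / u := by
    calc _ = R ^ 2 * (|discreteHeat k (R ^ 2 * u)| * |discreteHeat l (R ^ 2 * u)|) := by
          rw [abs_mul, abs_mul, abs_mul, abs_of_pos hR]; ring
      _ ≤ R ^ 2 * (((1 + a)⁻¹ ^ 2 / (R * √u)) * ((1 + b)⁻¹ ^ 2 / (R * √u))) := by
          rw [hsqrt] at hk' hl'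
          gcongr
      _ = ((1 + a) * (1 + b))⁻¹ ^ 2 / u := by
          rw [mul_inv]
          nth_rewrite 3 [← hsu]
          field_simp
      _ ≤ (1 + (a + b))⁻¹ ^ 2 / u := by
          gcongr
          nlinarith [mul_nonneg ha0 hb0]
      _ = _ := by rw [hab]
  rw [abs_mul, abs_of_pos (Real.rpow_pos_of_pos hu _)]
  have hp : 0 < u ^ (-1 - s) := Real.rpow_pos_of_pos hu _
  refine (mul_le_mul_of_nonneg_right hprod hp.le).trans ?_
  rw [kernelMajorant]
  split_ifs with h1
  · calc (1 + 1 / (8 * u))⁻¹ ^ 2 / u * u ^ (-1 - s)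
        ≤ (1 / (8 * u))⁻¹ ^ 2 / u * u ^ (-1 - s) := by
          gcongr
          linarith
      _ = 64 * (u ^ (1 : ℝ) * u ^ (-1 - s)) := by rw [Real.rpow_one]; field_simp; norm_num
      _ = 64 * u ^ (-s) := by rw [← Real.rpow_add hu]; congr 2; ring
  · calc (1 + 1 / (8 * u))⁻¹ ^ 2 / u * u ^ (-1 - s)
        ≤ 1 ^ 2 / u * u ^ (-1 - s) := by
          gcongr
          exact inv_le_one_of_one_le₀ (le_add_of_nonneg_right (by positivity))
      _ = u ^ (-1 : ℝ) * u ^ (-1 - s) := by rw [Real.rpow_neg_one]; field_simp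
      _ = u ^ (-2 - s) := by rw [← Real.rpow_add hu]; congr 1; ring

lemma abs_mul_sub_mul_le {a b A B δ M : ℝ} (ha : |a - A| ≤ δ) (hb : |b - B| ≤ δ)
    (hA : |A| ≤ M) (hB : |B| ≤ M) : |a * b - A * B| ≤ δ * δ + M * δ + δ * M := by
  have hδ : 0 ≤ δ := (abs_nonneg _).trans ha
  have hM : 0 ≤ M := (abs_nonneg _).trans hA
  calc |a * b - A * B| = |(a - A) * (b - B) + A * (b - B) + (a - A) * B| := by ring_nf
    _ ≤ |a - A| * |b - B| + |A| * |b - B| + |a - A| * |B| := by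
        rw [← abs_mul, ← abs_mul, ← abs_mul]; exact abs_add_three _ _ _
    _ ≤ _ := by gcongr

lemma tendsto_rescaled_kernel {u : ℝ} (hu : 0 < u) :
    Tendsto (fun p : ℕ × ℕ =>
      √((p.1 : ℝ) ^ 2 + (p.2 : ℝ) ^ 2) *
        discreteHeat p.1 (√((p.1 : ℝ) ^ 2 + (p.2 : ℝ) ^ 2) ^ 2 * u) *
      (√((p.1 : ℝ) ^ 2 + (p.2 : ℝ) ^ 2) *
        discreteHeat p.2 (√((p.1 : ℝ) ^ 2 + (p.2 : ℝ) ^ 2) ^ 2 * u)))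
      atTop (𝓝 (Real.exp (-(1 / (4 * u))) / (4 * π * u))) := by
  have hR : Tendsto (fun p : ℕ × ℕ => √((p.1 : ℝ) ^ 2 + (p.2 : ℝ) ^ 2)) atTop atTop := by
    have h1 : Tendsto (fun p : ℕ × ℕ => (p.1 : ℝ)) atTop atTop := by
      rw [← prod_atTop_atTop_eq]
      exact tendsto_natCast_atTop_atTop.comp tendsto_fst
    refine tendsto_atTop_mono (fun p => Real.le_sqrt_of_sq_le ?_) h1
    exact le_add_of_nonneg_right (by positivity)
  have hδ := (tendsto_symbolError hu).comp hR
  rw [tendsto_iff_norm_sub_tendsto_zero]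
  refine squeeze_zero' (.of_forall fun p => norm_nonneg _) ?_
    (by simpa using
      ((hδ.mul hδ).add (hδ.const_mul (√(4 * π * u))⁻¹)).add (hδ.mul_const (√(4 * π * u))⁻¹))
  filter_upwards [hR.eventually_gt_atTop 0] with p hp
  set R := √((p.1 : ℝ) ^ 2 + (p.2 : ℝ) ^ 2) with hRdef
  have hR2 : R ^ 2 = (p.1 : ℝ) ^ 2 + (p.2 : ℝ) ^ 2 := Real.sq_sqrt (by positivity)
  have hM : ∀ k : ℕ, |Real.exp (-(k ^ 2 / R ^ 2) / (4 * u)) / √(4 * π * u)| ≤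
      (√(4 * π * u))⁻¹ := by
    intro k
    rw [abs_of_nonneg (by positivity), div_eq_mul_inv]
    refine mul_le_of_le_one_left (by positivity) (Real.exp_le_one_iff.2 ?_)
    rw [neg_div, neg_nonpos]
    positivity
  have hlim : Real.exp (-(1 / (4 * u))) / (4 * π * u) =
      Real.exp (-((p.1 : ℝ) ^ 2 / R ^ 2) / (4 * u)) / √(4 * π * u) *
        (Real.exp (-((p.2 : ℝ) ^ 2 / R ^ 2) / (4 * u)) / √(4 * π * u)) := by
    rw [div_mul_div_comm, ← Real.exp_add, Real.mul_self_sqrt (by positivity), ← add_div,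
      ← neg_add, ← add_div, ← hR2, div_self (by positivity), neg_div]
  rw [hlim, Real.norm_eq_abs]
  exact abs_mul_sub_mul_le (abs_discreteHeat_sub_gaussian_le p.1 hu hp)
    (abs_discreteHeat_sub_gaussian_le p.2 hu hp) (hM _) (hM _)

lemma rpow_mul_integral_eq (k l : ℕ) {s R : ℝ} (hR : 0 < R) :
    R ^ (2 + 2 * s) * ∫ t in Set.Ioi (0 : ℝ),
      Real.exp (-4 * t) * besselI k (2 * t) * besselI l (2 * t) * t ^ (-1 - s) =
    ∫ u in Set.Ioi (0 : ℝ),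
      R * discreteHeat k (R ^ 2 * u) * (R * discreteHeat l (R ^ 2 * u)) * u ^ (-1 - s) := by
  have hR2 : 0 < R ^ 2 := by positivity
  have h := integral_comp_mul_left_Ioi (fun t =>
    Real.exp (-4 * t) * besselI k (2 * t) * besselI l (2 * t) * t ^ (-1 - s)) 0 hR2
  rw [mul_zero, smul_eq_mul, eq_inv_mul_iff_mul_eq₀ hR2.ne'] at h
  rw [← h, ← integral_const_mul, ← integral_const_mul]
  refine setIntegral_congr_fun measurableSet_Ioi fun u hu => ?_
  have hu : 0 < u := hu
  have hpow : R ^ (2 + 2 * s) * (R ^ 2 * u) ^ (-1 - s) = u ^ (-1 - s) := by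
    rw [Real.mul_rpow hR2.le hu.le, ← Real.rpow_natCast R 2, ← Real.rpow_mul hR.le, ← mul_assoc,
      ← Real.rpow_add hR]
    have : 2 + 2 * s + (2 : ℕ) * (-1 - s) = 0 := by push_cast; ring
    rw [this, Real.rpow_zero, one_mul]
  have hexp : Real.exp (-4 * (R ^ 2 * u)) =
      Real.exp (-2 * (R ^ 2 * u)) * Real.exp (-2 * (R ^ 2 * u)) := by
    rw [← Real.exp_add]; ring_nf
  simp only [discreteHeat, hexp]
  rw [← hpow]
  ring

lemma tendsto_rpow_mul_integral {s : ℝ} (hs0 : 0 < s) (hs1 : s < 1) :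
    Tendsto (fun p : ℕ × ℕ => √((p.1 : ℝ) ^ 2 + (p.2 : ℝ) ^ 2) ^ (2 + 2 * s) *
      ∫ t in Set.Ioi (0 : ℝ),
        Real.exp (-4 * t) * besselI p.1 (2 * t) * besselI p.2 (2 * t) * t ^ (-1 - s))
      atTop (𝓝 (4 ^ s * Real.Gamma (1 + s) / π)) := by
  rw [← integral_inv_mul_exp_neg_inv hs0]
  have hge : ∀ᶠ p : ℕ × ℕ in atTop, 4 ≤ p.1 ∧ 4 ≤ p.2 := by
    filter_upwards [eventually_ge_atTop ((4, 4) : ℕ × ℕ)] with p hp using hp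
  have hpos : ∀ p : ℕ × ℕ, 4 ≤ p.1 → 0 < √((p.1 : ℝ) ^ 2 + (p.2 : ℝ) ^ 2) := by
    intro p hp
    have : (4 : ℝ) ≤ p.1 := by exact_mod_cast hp
    positivity
  have hlim := tendsto_integral_filter_of_dominated_convergence
    (μ := volume.restrict (Set.Ioi (0 : ℝ))) (l := atTop)
    (F := fun (p : ℕ × ℕ) (u : ℝ) => √((p.1 : ℝ) ^ 2 + (p.2 : ℝ) ^ 2) *
        discreteHeat p.1 (√((p.1 : ℝ) ^ 2 + (p.2 : ℝ) ^ 2) ^ 2 * u) *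
      (√((p.1 : ℝ) ^ 2 + (p.2 : ℝ) ^ 2) *
        discreteHeat p.2 (√((p.1 : ℝ) ^ 2 + (p.2 : ℝ) ^ 2) ^ 2 * u)) * u ^ (-1 - s))
    (f := fun u => Real.exp (-(1 / (4 * u))) / (4 * π * u) * u ^ (-1 - s))
    (kernelMajorant s) ?_ ?_ (integrableOn_kernelMajorant hs0 hs1) ?_
  · refine hlim.congr' ?_
    filter_upwards [hge] with p hp
    exact (rpow_mul_integral_eq p.1 p.2 (hpos p hp.1)).symm
  · refine .of_forall fun p => Measurable.aestronglyMeasurable ?_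
    have h1 := (continuous_discreteHeat p.1).measurable
    have h2 := (continuous_discreteHeat p.2).measurable
    fun_prop
  · filter_upwards [hge] with p hp
    refine (ae_restrict_mem measurableSet_Ioi).mono fun u hu => ?_
    exact abs_rescaled_kernel_le hp.1 hp.2 (hpos p hp.1) (Real.sq_sqrt (by positivity)) hu
  · refine (ae_restrict_mem measurableSet_Ioi).mono fun u hu => ?_
    exact (tendsto_rescaled_kernel hu).mul_const _

theorem kernel_2d_asymptotics (s : ℝ) (hs0 : 0 < s) (hs1 : s < 1) :
    ∀ ε : ℝ, 0 < ε → ∃ N : ℕ, ∀ m₁ m₂ : ℤ, N ≤ m₁.natAbs → N ≤ m₂.natAbs →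
      |(((m₁ : ℝ) ^ 2 + (m₂ : ℝ) ^ 2) ^ ((1 : ℝ) / 2)) ^ (2 + 2 * s) * Ks2 s m₁ m₂ -
        4 ^ s * Real.Gamma (1 + s) / (Real.pi * |Real.Gamma (-s)|)| < ε := by
  intro ε hε
  have h := (tendsto_rpow_mul_integral hs0 hs1).const_mul (1 / |Real.Gamma (-s)|)
  obtain ⟨⟨N₁, N₂⟩, hN⟩ := Metric.tendsto_atTop.1 h ε hε
  refine ⟨max N₁ N₂, fun m₁ m₂ h₁ h₂ => ?_⟩
  have h3 := hN (m₁.natAbs, m₂.natAbs)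
    ⟨(le_max_left _ _).trans h₁, (le_max_right _ _).trans h₂⟩
  rw [Real.dist_eq] at h3
  have hsq : ∀ m : ℤ, ((m.natAbs : ℕ) : ℝ) ^ 2 = (m : ℝ) ^ 2 := fun m => by
    rw [Nat.cast_natAbs, Int.cast_abs, sq_abs]
  simp only [hsq] at h3
  rw [← Real.sqrt_eq_rpow, Ks2]
  convert h3 using 2
  ring
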